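/- arXiv:2410.10770 — 4 statements merged into one kernel-verified Lean document; each statement's English description precedes it below -/
import Mathlib

section
/- Let W be a classical channel from a finite alphabet 𝒳 to a finite alphabet 𝒴 and let M ∈ ℕ, M ≥ 1. Then 1 − ε^NS(W,M) ≥ 1 − ε^SR(W,M) ≥ (1/2)(1 − 1/e)·(1 − ε^NS(W,M)). -/
noncomputable section
open scoped BigOperators
open Classical
open scoped ComplexOrder

namespace ChannelSim

/-! ### Classical definitions -/

/-- A probability distribution on a finite type. -/
def IsProbDist {Y : Type*} [Fintype Y] (p : Y → ℝ) : Prop :=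
  (∀ y, 0 ≤ p y) ∧ ∑ y, p y = 1

/-- A classical channel: a stochastic matrix, i.e. each row is a probability distribution. -/
def IsChannel {X Y : Type*} [Fintype Y] (W : X → Y → ℝ) : Prop :=
  ∀ x, IsProbDist (W x)

/-- The `n`-fold product channel `W^{⊗n}`. -/
def prodChannel {X Y : Type*} (W : X → Y → ℝ) (n : ℕ) :
    (Fin n → X) → (Fin n → Y) → ℝ :=
  fun xs ys => ∏ i, W (xs i) (ys i)

/-- The `n`-fold product distribution `q^{⊗n}`. -/
def prodDist {Y : Type*} (q : Y → ℝ) (n : ℕ) : (Fin n → Y) → ℝ :=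
  fun ys => ∏ i, q (ys i)

/-- Fidelity of probability distributions on a finite type. -/
def cFid {Y : Type*} [Fintype Y] (p q : Y → ℝ) : ℝ :=
  (∑ y, Real.sqrt (p y * q y)) ^ 2

/-- Purified distance of probability distributions on a finite type. -/
def cPD {Y : Type*} [Fintype Y] (p q : Y → ℝ) : ℝ :=
  Real.sqrt (1 - cFid p q)

/-- Non-signaling simulation error of a classical channel with communication size `M`. -/
def cEpsNS {X Y : Type*} [Fintype X] [Fintype Y] (W : X → Y → ℝ) (M : ℝ) : ℝ :=
  sInf { e : ℝ | ∃ (W' : X → Y → ℝ) (q : Y → ℝ), IsChannel W' ∧ IsProbDist q ∧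
    (∀ x y, W' x y ≤ M * q y) ∧ e = ⨆ x, cPD (W x) (W' x) }

/-- Shared-randomness simulation error of a classical channel with communication size `M`. -/
def cEpsSR {X Y : Type*} [Fintype X] [Fintype Y] (W : X → Y → ℝ) (M : ℝ) : ℝ :=
  sInf { e : ℝ | ∃ (k m : ℕ) (pS : Fin k → ℝ) (Enc : X → Fin k → Fin m → ℝ)
    (Dec : Fin m → Fin k → Y → ℝ),
    IsProbDist pS ∧ (∀ x s, IsProbDist (Enc x s)) ∧ (∀ i s, IsProbDist (Dec i s)) ∧
    (m : ℝ) ≤ M ∧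
    e = ⨆ x, cPD (W x) (fun y => ∑ s, pS s * ∑ i, Enc x s i * Dec i s y) }

/-- Classical Rényi divergence of order `α > 0`, with values in the extended reals:
the Kullback–Leibler divergence at `α = 1`, and `+∞` whenever `α > 1` (or `α = 1`)
and the support of `p` is not contained in that of `q`. -/
def cRenyiD {Y : Type*} [Fintype Y] (α : ℝ) (p q : Y → ℝ) : EReal :=
  if α = 1 then
    (if ∀ y, q y = 0 → p y = 0 then
      ((∑ y, p y * Real.log (p y / q y) : ℝ) : EReal) else (⊤ : EReal))
  else if 1 < α ∧ ¬ (∀ y, q y = 0 → p y = 0) then (⊤ : EReal)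
  else (((α - 1)⁻¹ * Real.log (∑ y, p y ^ α * q y ^ (1 - α)) : ℝ) : EReal)

/-- Rényi mutual information `I_α(W) = inf_q sup_x D_α(W(·|x)‖q)` of a classical channel. -/
def cRenyiMI {X Y : Type*} [Fintype X] [Fintype Y] (α : ℝ) (W : X → Y → ℝ) : EReal :=
  ⨅ q : {q : Y → ℝ // IsProbDist q}, ⨆ x, cRenyiD α (W x) q.1

/-- Kullback–Leibler divergence (real-valued formula, valid on matching supports). -/
def cKL {Y : Type*} [Fintype Y] (p q : Y → ℝ) : ℝ :=
  ∑ y, p y * Real.log (p y / q y)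

/-- Relative-entropy variance (real-valued formula, valid on matching supports). -/
def cVar {Y : Type*} [Fintype Y] (p q : Y → ℝ) : ℝ :=
  (∑ y, p y * (Real.log (p y / q y)) ^ 2) - (cKL p q) ^ 2

/-- The empirical type of a word `xs ∈ X^n`. -/
def empType {X : Type*} [Fintype X] {n : ℕ} (xs : Fin n → X) : X → ℝ :=
  fun x => (Finset.univ.filter fun i => xs i = x).card / n

/-! ### Quantum definitions -/

/-- A density matrix: positive semidefinite with unit trace. -/
def IsDensity {n : Type*} [Fintype n] [DecidableEq n] (ρ : Matrix n n ℂ) : Prop :=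
  ρ.PosSemidef ∧ ρ.trace = 1

/-- Functional calculus for Hermitian matrices (junk value `0` on non-Hermitian input). -/
def matFun {n : Type*} [Fintype n] [DecidableEq n] (f : ℝ → ℝ) (A : Matrix n n ℂ) :
    Matrix n n ℂ :=
  if hA : A.IsHermitian then
    (hA.eigenvectorUnitary : Matrix n n ℂ) *
      Matrix.diagonal (fun i => ((f (hA.eigenvalues i)) : ℂ)) *
      (star (hA.eigenvectorUnitary : Matrix n n ℂ))
  else 0

/-- Fidelity of density matrices: `F(ρ,σ) = (Tr √(√ρ σ √ρ))²`. -/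
def qFid {n : Type*} [Fintype n] [DecidableEq n] (ρ σ : Matrix n n ℂ) : ℝ :=
  ((matFun Real.sqrt (matFun Real.sqrt ρ * σ * matFun Real.sqrt ρ)).trace).re ^ 2

/-- Purified distance of density matrices. -/
def qPD {n : Type*} [Fintype n] [DecidableEq n] (ρ σ : Matrix n n ℂ) : ℝ :=
  Real.sqrt (1 - qFid ρ σ)

/-- Non-signaling simulation error of a classical-quantum channel with communication size `M`. -/
def qEpsNS {X B : Type*} [Fintype X] [Fintype B] [DecidableEq B]
    (W : X → Matrix B B ℂ) (M : ℝ) : ℝ :=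
  sInf { e : ℝ | ∃ (W' : X → Matrix B B ℂ) (σ : Matrix B B ℂ),
    (∀ x, IsDensity (W' x)) ∧ IsDensity σ ∧ (∀ x, (M • σ - W' x).PosSemidef) ∧
    e = ⨆ x, qPD (W x) (W' x) }

/-- Support inclusion `supp ρ ⊆ supp σ` for positive semidefinite matrices, expressed
via kernels: every vector killed by `σ` is killed by `ρ`. -/
def suppLE {n : Type*} [Fintype n] (ρ σ : Matrix n n ℂ) : Prop :=
  ∀ v, σ.mulVec v = 0 → ρ.mulVec v = 0

/-- Umegaki relative entropy `D(ρ‖σ) = Tr ρ (log ρ − log σ)` (logarithms on supports;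
real-valued formula, valid when `supp ρ ⊆ supp σ`). -/
def relEntQ {n : Type*} [Fintype n] [DecidableEq n] (ρ σ : Matrix n n ℂ) : ℝ :=
  ((ρ * (matFun Real.log ρ - matFun Real.log σ)).trace).re

/-- Quantum relative-entropy variance `Tr ρ (log ρ − log σ)² − D(ρ‖σ)²`. -/
def varQ {n : Type*} [Fintype n] [DecidableEq n] (ρ σ : Matrix n n ℂ) : ℝ :=
  ((ρ * (matFun Real.log ρ - matFun Real.log σ) ^ 2).trace).re - (relEntQ ρ σ) ^ 2

/-- Sandwiched Rényi divergence of order `α`, valued in the extended reals: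
`D̃_α(ρ‖σ) = (α−1)⁻¹ log Tr (σ^{(1−α)/(2α)} ρ σ^{(1−α)/(2α)})^α`, with the Umegaki relative
entropy at `α = 1`, and `+∞` when `α ≥ 1` and `supp ρ ⊄ supp σ`, or `α < 1` and `ρσ = 0`. -/
def sandD {n : Type*} [Fintype n] [DecidableEq n] (α : ℝ) (ρ σ : Matrix n n ℂ) : EReal :=
  if α = 1 then (if suppLE ρ σ then ((relEntQ ρ σ : ℝ) : EReal) else (⊤ : EReal))
  else if (1 < α ∧ ¬ suppLE ρ σ) ∨ (α < 1 ∧ ρ * σ = 0) then (⊤ : EReal)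
  else (((α - 1)⁻¹ * Real.log
      (((matFun (fun t => t ^ α)
        (matFun (fun t => t ^ ((1 - α) / (2 * α))) σ * ρ *
          matFun (fun t => t ^ ((1 - α) / (2 * α))) σ)).trace).re) : ℝ) : EReal)

/-- Sandwiched Rényi mutual information `Ĩ_α(W) = inf_σ sup_x D̃_α(W_x‖σ)` of a CQ channel. -/
def sandMI {X B : Type*} [Fintype X] [Fintype B] [DecidableEq B]
    (α : ℝ) (W : X → Matrix B B ℂ) : EReal :=
  ⨅ σ : {σ : Matrix B B ℂ // IsDensity σ}, ⨆ x, sandD α (W x) σ.1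

/-- `n`-fold tensor power `ρ^{⊗n}` of a matrix, realized on the index set `Fin n → B`. -/
def tensPow {B : Type*} (ρ : Matrix B B ℂ) (n : ℕ) :
    Matrix (Fin n → B) (Fin n → B) ℂ :=
  Matrix.of fun a b => ∏ i, ρ (a i) (b i)

/-- Tensor product `V_1 ⊗ ⋯ ⊗ V_k` of a family of matrices. -/
def tensProd {B : Type*} {k : ℕ} (V : Fin k → Matrix B B ℂ) :
    Matrix (Fin k → B) (Fin k → B) ℂ :=
  Matrix.of fun a b => ∏ i, V i (a i) (b i)

/-- The `n`-fold product CQ channel `W^{⊗n}`. -/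
def cqPow {X B : Type*} (W : X → Matrix B B ℂ) (n : ℕ) :
    (Fin n → X) → Matrix (Fin n → B) (Fin n → B) ℂ :=
  fun xs => Matrix.of fun a b => ∏ i, W (xs i) (a i) (b i)

/-- Minimal positive eigenvalue of a Hermitian matrix (junk value `0` otherwise). -/
def minPosEig {n : Type*} [Fintype n] [DecidableEq n] (A : Matrix n n ℂ) : ℝ :=
  if hA : A.IsHermitian then sInf {t : ℝ | 0 < t ∧ ∃ i, hA.eigenvalues i = t} else 0

/-- Extended-real exponential, sending `⊥ = −∞` to `0`. -/
def expE (x : EReal) : ℝ := if x = ⊥ then 0 else Real.exp x.toReal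


/-- The joint classical–quantum state `W∘p = Σ_x p(x) |x⟩⟨x| ⊗ W_x` as a block-diagonal
matrix on `ℂ^{|X|} ⊗ B`. -/
def cqJoint {X B : Type*} [DecidableEq X] (p : X → ℝ) (W : X → Matrix B B ℂ) :
    Matrix (X × B) (X × B) ℂ :=
  Matrix.of fun a b => if a.1 = b.1 then (p a.1 : ℂ) * W a.1 a.2 b.2 else 0

end ChannelSim

namespace ChannelSim

open Finset

lemma cFid_nonneg {Y : Type*} [Fintype Y] (p q : Y → ℝ) : 0 ≤ cFid p q := sq_nonneg _

lemma cFid_le_one {Y : Type*} [Fintype Y] {p q : Y → ℝ} (hp : IsProbDist p)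
    (hq : IsProbDist q) : cFid p q ≤ 1 := by
  have h : ∑ y, Real.sqrt (p y * q y) ≤ ∑ y, (p y + q y) / 2 := by
    refine sum_le_sum fun y _ => Real.sqrt_le_iff.2 ⟨?_, ?_⟩
    · linarith [hp.1 y, hq.1 y]
    · nlinarith [sq_nonneg (p y - q y)]
  rw [← sum_div, sum_add_distrib, hp.2, hq.2] at h
  exact pow_le_one₀ (sum_nonneg fun y _ => Real.sqrt_nonneg _) (by linarith)

/-- Fidelity is monotone and homogeneous in its second argument. -/
lemma mul_cFid_le {Y : Type*} [Fintype Y] {p q r : Y → ℝ} {c : ℝ} (hc : 0 ≤ c)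
    (hp : ∀ y, 0 ≤ p y) (h : ∀ y, c * q y ≤ r y) : c * cFid p q ≤ cFid p r := by
  unfold cFid
  rw [← Real.sq_sqrt hc, ← mul_pow, mul_sum]
  refine pow_le_pow_left₀ (sum_nonneg fun y _ => by positivity) (sum_le_sum fun y _ => ?_) 2
  rw [← Real.sqrt_mul hc]
  exact Real.sqrt_le_sqrt (by nlinarith [mul_le_mul_of_nonneg_left (h y) (hp y)])

lemma cPD_le_of_mul_le {Y : Type*} [Fintype Y] {p q r : Y → ℝ} {c : ℝ} (hc : 0 ≤ c)
    (hp : IsProbDist p) (hq : IsProbDist q) (hr : IsProbDist r) (h : ∀ y, c * q y ≤ r y) :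
    cPD p r ≤ 1 - c / 2 * (1 - cPD p q) := by
  have h1 := mul_cFid_le hc hp.1 h
  have h2 := cFid_le_one hp hq
  have h3 := cFid_le_one hp hr
  have h4 := cFid_nonneg p q
  have h5 : 1 - cFid p q ≤ cPD p q :=
    Real.le_sqrt_of_sq_le (by nlinarith)
  have h6 : cPD p r ≤ 1 - cFid p r / 2 :=
    Real.sqrt_le_iff.2 ⟨by linarith, by nlinarith [sq_nonneg (cFid p r)]⟩
  nlinarith [mul_le_mul_of_nonneg_left h5 hc]

lemma bddAbove_cPD {X Y : Type*} [Finite X] [Fintype Y] (W V : X → Y → ℝ) :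
    BddAbove (Set.range fun x => cPD (W x) (V x)) := (Set.finite_range _).bddAbove

section Rejection

variable {Y : Type*} {M : ℕ}

/-- The index of the first accepted sample when sample `v` is accepted with probability `a v`;
index `0` if every sample is rejected. -/
def rejEnc [NeZero M] (a : Y → ℝ) (u : Fin M → Y) (i : Fin M) : ℝ :=
  a (u i) * ∏ j with j < i, (1 - a (u j)) + if i = 0 then ∏ j, (1 - a (u j)) else 0

lemma isProbDist_rejEnc [NeZero M] {a : Y → ℝ} (h0 : ∀ y, 0 ≤ a y) (h1 : ∀ y, a y ≤ 1)
    (u : Fin M → Y) :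
    IsProbDist (rejEnc a u) := by
  have hp (s : Finset (Fin M)) : 0 ≤ ∏ j ∈ s, (1 - a (u j)) :=
    prod_nonneg fun j _ => sub_nonneg.2 (h1 _)
  constructor
  · intro i
    refine add_nonneg (mul_nonneg (h0 _) (hp _)) ?_
    split_ifs
    exacts [hp _, le_rfl]
  · have h := prod_one_sub_ordered (univ : Finset (Fin M)) fun j => a (u j)
    simp only [rejEnc, sum_add_distrib, sum_ite_eq', mem_univ, if_true]
    linarith

variable [Fintype Y]

lemma isProbDist_prod {q : Y → ℝ} (hq : IsProbDist q) :
    IsProbDist fun u : Fin M → Y => ∏ i, q (u i) := by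
  refine ⟨fun u => prod_nonneg fun i _ => hq.1 _, ?_⟩
  rw [← Fintype.piFinset_univ, ← prod_univ_sum (fun _ => univ) fun _ => q]
  simp [hq.2]

lemma sum_first_accept {q a : Y → ℝ} (hq : IsProbDist q) (haq : ∑ v, q v * a v = 1 / M)
    (y : Y) (i : Fin M) :
    ∑ u : Fin M → Y, (∏ j, q (u j)) *
      ((a (u i) * ∏ j with j < i, (1 - a (u j))) * if u i = y then 1 else 0) =
    q y * a y * ∏ j : Fin M with j < i, (1 - 1 / (M : ℝ)) := by
  let g (j : Fin M) (v : Y) : ℝ :=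
    q v * ((if j < i then 1 - a v else 1) * if j = i then a v * (if v = y then 1 else 0) else 1)
  have h1 (u : Fin M → Y) : (∏ j, q (u j)) *
      ((a (u i) * ∏ j with j < i, (1 - a (u j))) * if u i = y then 1 else 0) =
      ∏ j, g j (u j) := by
    simp only [g, prod_mul_distrib, prod_filter, prod_ite_eq', mem_univ, if_true]
    ring
  have h2 (j : Fin M) : ∑ v, g j v =
      (if j < i then 1 - 1 / (M : ℝ) else 1) * if j = i then q y * a y else 1 := by
    by_cases hji : j = i
    · subst hji
      simp [g]
    · by_cases hlt : j < i
      · simp only [g, hji, hlt, if_true, if_false, mul_one, mul_sub, sum_sub_distrib, hq.2, haq]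
      · simp [g, hji, hlt, hq.2]
  simp_rw [h1]
  rw [← Fintype.piFinset_univ, ← prod_univ_sum]
  simp only [h2, prod_mul_distrib, prod_filter, prod_ite_eq', mem_univ, if_true]
  ring

lemma le_rejection [NeZero M] {q a : Y → ℝ} (hq : IsProbDist q) (h0 : ∀ y, 0 ≤ a y)
    (h1 : ∀ y, a y ≤ 1)
    (haq : ∑ v, q v * a v = 1 / M) (y : Y) :
    (1 - 1 / Real.exp 1) * (M * (q y * a y)) ≤
      ∑ u : Fin M → Y, (∏ j, q (u j)) * ∑ i, rejEnc a u i * if u i = y then 1 else 0 := by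
  have hM : (0 : ℝ) < M := by exact_mod_cast NeZero.pos M
  have hM1 : (1 : ℝ) ≤ M := by exact_mod_cast NeZero.one_le
  have hexp : (1 - 1 / (M : ℝ)) ^ M ≤ 1 / Real.exp 1 := by
    have := Real.one_sub_div_pow_le_exp_neg (n := M) (t := 1) hM1
    rwa [Real.exp_neg, ← one_div] at this
  have hsum : 1 - (1 - 1 / (M : ℝ)) ^ M =
      ∑ i : Fin M, 1 / (M : ℝ) * ∏ j : Fin M with j < i, (1 - 1 / (M : ℝ)) := by
    have h := prod_one_sub_ordered (univ : Finset (Fin M)) fun _ => 1 / (M : ℝ)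
    rw [prod_const, card_univ, Fintype.card_fin] at h
    linarith
  calc (1 - 1 / Real.exp 1) * (M * (q y * a y))
      ≤ (1 - (1 - 1 / (M : ℝ)) ^ M) * (M * (q y * a y)) := by
        refine mul_le_mul_of_nonneg_right (by linarith) ?_
        exact mul_nonneg hM.le (mul_nonneg (hq.1 y) (h0 y))
    _ = ∑ i : Fin M, q y * a y * ∏ j : Fin M with j < i, (1 - 1 / (M : ℝ)) := by
        rw [hsum, sum_mul]
        refine sum_congr rfl fun i _ => ?_
        field_simp
    _ = ∑ u : Fin M → Y, (∏ j, q (u j)) * ∑ i,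
          (a (u i) * ∏ j with j < i, (1 - a (u j))) * if u i = y then 1 else 0 := by
        simp_rw [mul_sum]
        rw [sum_comm]
        exact sum_congr rfl fun i _ => (sum_first_accept hq haq y i).symm
    _ ≤ _ := by
        refine sum_le_sum fun u _ => mul_le_mul_of_nonneg_left ?_ (prod_nonneg fun j _ => hq.1 _)
        refine sum_le_sum fun i _ => mul_le_mul_of_nonneg_right ?_ (by split_ifs <;> simp)
        refine le_add_of_nonneg_right ?_
        split_ifs
        exacts [prod_nonneg fun j _ => sub_nonneg.2 (h1 _), le_rfl]

end Rejection

lemma isProbDist_simulated {S I Y : Type*} [Fintype S] [Fintype I] [Fintype Y]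
    {pS : S → ℝ} {E : S → I → ℝ} {D : I → S → Y → ℝ} (hp : IsProbDist pS)
    (hE : ∀ s, IsProbDist (E s)) (hD : ∀ i s, IsProbDist (D i s)) :
    IsProbDist fun y => ∑ s, pS s * ∑ i, E s i * D i s y := by
  constructor
  · exact fun y => sum_nonneg fun s _ => mul_nonneg (hp.1 s)
      (sum_nonneg fun i _ => mul_nonneg ((hE s).1 i) ((hD i s).1 y))
  · rw [sum_comm]
    simp_rw [← mul_sum]
    have h (s : S) : ∑ y, ∑ i, E s i * D i s y = 1 := by
      rw [sum_comm]
      simp_rw [← mul_sum, (hD _ s).2, mul_one, (hE s).2]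
    simp_rw [h, mul_one, hp.2]

/-- The shared-randomness strategy obtained from a non-signaling one by rejection sampling. -/
lemma exists_rounding {X Y : Type*} [Fintype Y] {V : X → Y → ℝ} {q : Y → ℝ} {M : ℕ}
    (hM : 1 ≤ M) (hV : IsChannel V) (hq : IsProbDist q) (h : ∀ x y, V x y ≤ M * q y) :
    ∃ (k : ℕ) (pS : Fin k → ℝ) (Enc : X → Fin k → Fin M → ℝ) (Dec : Fin M → Fin k → Y → ℝ),
      IsProbDist pS ∧ (∀ x s, IsProbDist (Enc x s)) ∧ (∀ i s, IsProbDist (Dec i s)) ∧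
      ∀ x y, (1 - 1 / Real.exp 1) * V x y ≤ ∑ s, pS s * ∑ i, Enc x s i * Dec i s y := by
  have : NeZero M := ⟨by omega⟩
  have hM0 : (0 : ℝ) < M := by exact_mod_cast hM
  let a (x : X) (y : Y) : ℝ := V x y / (M * q y)
  have ha0 (x y) : 0 ≤ a x y := div_nonneg ((hV x).1 y) (mul_nonneg hM0.le (hq.1 y))
  have ha1 (x y) : a x y ≤ 1 := div_le_one_of_le₀ (h x y) (mul_nonneg hM0.le (hq.1 y))
  have hqa (x y) : q y * a x y = V x y / M := by
    rcases eq_or_ne (q y) 0 with h0 | h0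
    · have : V x y = 0 := le_antisymm (by simpa [h0] using h x y) ((hV x).1 y)
      simp [h0, this]
    · simp only [a]
      field_simp
  let e := (Fintype.equivFin (Fin M → Y)).symm
  have hprod := isProbDist_prod (M := M) hq
  refine ⟨_, fun s => ∏ i, q (e s i), fun x s => rejEnc (a x) (e s),
    fun i s y => if e s i = y then 1 else 0, ⟨fun s => hprod.1 _, ?_⟩,
    fun x s => isProbDist_rejEnc (ha0 x) (ha1 x) _,
    fun i s => ⟨fun y => by dsimp only; split_ifs <;> simp, by simp⟩, fun x y => ?_⟩
  · rw [e.sum_comp fun u => ∏ i, q (u i)]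
    exact hprod.2
  · have h1 := le_rejection hq (ha0 x) (ha1 x)
      (by simp_rw [hqa]; rw [← sum_div, (hV x).2]) y
    rw [hqa, mul_div_cancel₀ _ hM0.ne'] at h1
    refine h1.trans (le_of_eq ?_)
    exact (e.sum_comp fun u => (∏ j, q (u j)) *
      ∑ i, rejEnc (a x) u i * if u i = y then 1 else 0).symm

/-- A shared-randomness simulation is in particular a non-signaling one. -/
lemma exists_le_mul_of_simulated {X Y : Type*} [Nonempty X] [Fintype Y] {k m : ℕ} {M : ℝ}
    {pS : Fin k → ℝ} {Enc : X → Fin k → Fin m → ℝ} {Dec : Fin m → Fin k → Y → ℝ}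
    (hp : IsProbDist pS) (hE : ∀ x s, IsProbDist (Enc x s)) (hD : ∀ i s, IsProbDist (Dec i s))
    (hm : (m : ℝ) ≤ M) :
    ∃ q : Y → ℝ, IsProbDist q ∧
      ∀ x y, ∑ s, pS s * ∑ i, Enc x s i * Dec i s y ≤ M * q y := by
  have hk : Nonempty (Fin k) := by
    by_contra hk
    rw [not_nonempty_iff] at hk
    simpa using hp.2
  have hm0 : (m : ℝ) ≠ 0 := by
    rintro h0
    obtain rfl : m = 0 := by exact_mod_cast h0
    simpa using (hE (Classical.arbitrary X) hk.some).2
  have hq : IsProbDist fun y => ∑ s, pS s * ∑ i, (1 / (m : ℝ)) * Dec i s y :=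
    isProbDist_simulated hp
      (fun s => ⟨fun i => by positivity, by simp [mul_inv_cancel₀ hm0]⟩) hD
  refine ⟨_, hq, fun x y => le_trans ?_ (mul_le_mul_of_nonneg_right hm (hq.1 y))⟩
  rw [mul_sum]
  refine sum_le_sum fun s _ => ?_
  rw [mul_left_comm, ← mul_sum, ← mul_assoc (m : ℝ), mul_one_div_cancel hm0, one_mul]
  refine mul_le_mul_of_nonneg_left (sum_le_sum fun i _ => ?_) (hp.1 s)
  refine mul_le_of_le_one_left ((hD i s).1 y) ?_
  rw [← (hE x s).2]
  exact single_le_sum (fun j _ => (hE x s).1 j) (mem_univ i)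

lemma cEpsNS_le {X Y : Type*} [Fintype X] [Fintype Y] {W V : X → Y → ℝ} {q : Y → ℝ} {M : ℝ}
    (hV : IsChannel V) (hq : IsProbDist q) (h : ∀ x y, V x y ≤ M * q y) :
    cEpsNS W M ≤ ⨆ x, cPD (W x) (V x) := by
  refine csInf_le ⟨0, ?_⟩ ⟨V, q, hV, hq, h, rfl⟩
  rintro _ ⟨_, _, _, _, _, rfl⟩
  exact Real.iSup_nonneg fun x => Real.sqrt_nonneg _

lemma cEpsSR_le {X Y : Type*} [Fintype X] [Fintype Y] {W : X → Y → ℝ} {M : ℝ} {k m : ℕ}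
    {pS : Fin k → ℝ} {Enc : X → Fin k → Fin m → ℝ} {Dec : Fin m → Fin k → Y → ℝ}
    (hp : IsProbDist pS) (hE : ∀ x s, IsProbDist (Enc x s)) (hD : ∀ i s, IsProbDist (Dec i s))
    (hm : (m : ℝ) ≤ M) :
    cEpsSR W M ≤ ⨆ x, cPD (W x) (fun y => ∑ s, pS s * ∑ i, Enc x s i * Dec i s y) := by
  refine csInf_le ⟨0, ?_⟩ ⟨k, m, pS, Enc, Dec, hp, hE, hD, hm, rfl⟩
  rintro _ ⟨_, _, _, _, _, _, _, _, _, rfl⟩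
  exact Real.iSup_nonneg fun x => Real.sqrt_nonneg _

end ChannelSim

open ChannelSim in
/-- rounding of non-signaling strategies to shared-randomness strategies for
classical channel simulation. -/
theorem statement9 {X Y : Type*} [Fintype X] [Nonempty X] [Fintype Y]
    (W : X → Y → ℝ) (hW : IsChannel W) (M : ℕ) (hM : 1 ≤ M) :
    1 - cEpsSR W M ≤ 1 - cEpsNS W M ∧
    (1 / 2 : ℝ) * (1 - 1 / Real.exp 1) * (1 - cEpsNS W M) ≤ 1 - cEpsSR W M := by
  obtain ⟨x₀⟩ := ‹Nonempty X›
  have : Nonempty X := ⟨x₀⟩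
  have hM1 : (1 : ℝ) ≤ M := by exact_mod_cast hM
  have hconst (x : X) (y : Y) : W x₀ y ≤ M * W x₀ y :=
    le_mul_of_one_le_left ((hW x₀).1 y) hM1
  constructor
  · refine sub_le_sub_left (le_csInf ?_ ?_) 1
    · obtain ⟨k, pS, Enc, Dec, hp, hE, hD, -⟩ :=
        exists_rounding (X := X) hM (fun _ => hW x₀) (hW x₀) hconst
      exact ⟨_, k, M, pS, Enc, Dec, hp, hE, hD, le_rfl, rfl⟩
    · rintro _ ⟨k, m, pS, Enc, Dec, hp, hE, hD, hm, rfl⟩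
      obtain ⟨q, hq, h⟩ := exists_le_mul_of_simulated hp hE hD hm
      exact cEpsNS_le (fun x => isProbDist_simulated hp (hE x) hD) hq h
  · have hc : 0 < 1 - 1 / Real.exp 1 := by
      rw [sub_pos, div_lt_one (Real.exp_pos 1)]
      exact Real.one_lt_exp_iff.2 one_pos
    set c := 1 - 1 / Real.exp 1
    suffices h : 1 - 2 / c * (1 - cEpsSR W M) ≤ cEpsNS W M by
      calc 1 / 2 * c * (1 - cEpsNS W M)
          ≤ 1 / 2 * c * (2 / c * (1 - cEpsSR W M)) :=
            mul_le_mul_of_nonneg_left (by linarith) (by positivity)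
        _ = 1 - cEpsSR W M := by field_simp
    refine le_csInf ⟨_, fun _ => W x₀, W x₀, fun _ => hW x₀, hW x₀, hconst, rfl⟩ ?_
    rintro _ ⟨V, q, hV, hq, h, rfl⟩
    obtain ⟨k, pS, Enc, Dec, hp, hE, hD, hle⟩ := exists_rounding hM hV hq h
    set ε := ⨆ x, cPD (W x) (V x)
    have hSR : cEpsSR W M ≤ 1 - c / 2 * (1 - ε) := by
      refine (cEpsSR_le hp hE hD le_rfl).trans (ciSup_le fun x => ?_)
      have h1 := cPD_le_of_mul_le hc.le (hW x) (hV x)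
        (isProbDist_simulated hp (hE x) hD) (hle x)
      have h2 : cPD (W x) (V x) ≤ ε := le_ciSup (bddAbove_cPD W V) x
      nlinarith
    have h3 : 1 - ε ≤ 2 / c * (1 - cEpsSR W M) := by
      calc 1 - ε = 2 / c * (c / 2 * (1 - ε)) := by field_simp
        _ ≤ _ := mul_le_mul_of_nonneg_left (by linarith) (by positivity)
    linarith
end
end

section
/- Let W be a classical channel from a finite alphabet 𝒳 to a finite alphabet 𝒴 and let M ≥ 1. Then ε^NS(W,M) = sup_{p ∈ P(𝒳)} inf{ P(W∘p, W̃∘p) : W̃ a classical channel from 𝒳 to 𝒴, q a probability distribution on 𝒴, and W̃(y|x) ≤ M·q(y) for all x∈𝒳, y∈𝒴 }, where W∘p denotes the joint distribution on 𝒳×𝒴 given by (W∘p)(x,y) = p(x)·W(y|x). -/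
noncomputable section
open scoped BigOperators
open Classical
open scoped ComplexOrder

namespace ChannelSim

/-- The Bhattacharyya coefficient of two distributions on a finite type. -/
def bhattacharyya {Y : Type*} [Fintype Y] (p q : Y → ℝ) : ℝ :=
  ∑ y, Real.sqrt (p y * q y)

/-- The pairs `(W', q)` of a channel and a distribution with `W' x y ≤ M * q y`. -/
def simSet (X Y : Type*) [Fintype Y] (M : ℝ) : Set ((X → Y → ℝ) × (Y → ℝ)) :=
  {w | IsChannel w.1 ∧ IsProbDist w.2 ∧ ∀ x y, w.1 x y ≤ M * w.2 y}

lemma bhattacharyya_nonneg {Y : Type*} [Fintype Y] (p q : Y → ℝ) : 0 ≤ bhattacharyya p q :=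
  Finset.sum_nonneg fun _ _ => Real.sqrt_nonneg _

lemma cPD_eq {Y : Type*} [Fintype Y] (p q : Y → ℝ) :
    cPD p q = Real.sqrt (1 - bhattacharyya p q ^ 2) := rfl

lemma cPD_nonneg {Y : Type*} [Fintype Y] (p q : Y → ℝ) : 0 ≤ cPD p q := Real.sqrt_nonneg _

lemma cPD_le_one {Y : Type*} [Fintype Y] (p q : Y → ℝ) : cPD p q ≤ 1 := by
  rw [cPD_eq, Real.sqrt_le_one]
  linarith [sq_nonneg (bhattacharyya p q)]

/-- The purified distance is antitone in the Bhattacharyya coefficient. -/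
lemma cPD_le_cPD {Y Z : Type*} [Fintype Y] [Fintype Z] {p q : Y → ℝ} {r s : Z → ℝ}
    (h : bhattacharyya r s ≤ bhattacharyya p q) : cPD p q ≤ cPD r s := by
  rw [cPD_eq, cPD_eq]
  exact Real.sqrt_le_sqrt (sub_le_sub_left (pow_le_pow_left₀ (bhattacharyya_nonneg r s) h 2) 1)

/-- The Bhattacharyya coefficient of the joint distributions `W∘p` and `W'∘p` is the average of
the coefficients of the rows. -/
lemma bhattacharyya_joint {X Y : Type*} [Fintype X] [Fintype Y] {p : X → ℝ} (hp : ∀ x, 0 ≤ p x)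
    (W W' : X → Y → ℝ) :
    bhattacharyya (fun z : X × Y => p z.1 * W z.1 z.2) (fun z => p z.1 * W' z.1 z.2) =
      ∑ x, p x * bhattacharyya (W x) (W' x) := by
  simp only [bhattacharyya, Fintype.sum_prod_type, Finset.mul_sum]
  refine Finset.sum_congr rfl fun x _ => Finset.sum_congr rfl fun y _ => ?_
  rw [mul_mul_mul_comm, Real.sqrt_mul (mul_self_nonneg _), Real.sqrt_mul_self (hp x)]

lemma continuous_bhattacharyya {Y : Type*} [Fintype Y] (p : Y → ℝ) :
    Continuous (bhattacharyya p) := by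
  unfold bhattacharyya
  fun_prop

lemma concaveOn_bhattacharyya {Y : Type*} [Fintype Y] {p : Y → ℝ} (hp : ∀ y, 0 ≤ p y) :
    ConcaveOn ℝ {q : Y → ℝ | ∀ y, 0 ≤ q y} (bhattacharyya p) := by
  refine ⟨fun q hq r hr a b ha hb _ y => add_nonneg (mul_nonneg ha (hq y)) (mul_nonneg hb (hr y)),
    fun q hq r hr a b ha hb hab => ?_⟩
  simp only [bhattacharyya, smul_eq_mul, Finset.mul_sum, ← Finset.sum_add_distrib]
  refine Finset.sum_le_sum fun y _ => ?_
  have h := Real.strictConcaveOn_sqrt.concaveOn.2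
    (hq y : q y ∈ Set.Ici (0 : ℝ)) (hr y : r y ∈ Set.Ici (0 : ℝ)) ha hb hab
  simp only [smul_eq_mul] at h
  simp only [Pi.add_apply, Pi.smul_apply, smul_eq_mul, Real.sqrt_mul (hp y)]
  nlinarith [mul_le_mul_of_nonneg_left h (Real.sqrt_nonneg (p y))]

lemma convex_simSet (X Y : Type*) [Fintype Y] (M : ℝ) : Convex ℝ (simSet X Y M) := by
  rintro ⟨V, q⟩ ⟨hV, hq, hVq⟩ ⟨V', q'⟩ ⟨hV', hq', hVq'⟩ a b ha hb hab
  refine ⟨fun x => convex_stdSimplex ℝ Y (hV x) (hV' x) ha hb hab,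
    convex_stdSimplex ℝ Y hq hq' ha hb hab, fun x y => ?_⟩
  have h := mul_le_mul_of_nonneg_left (hVq x y) ha
  have h' := mul_le_mul_of_nonneg_left (hVq' x y) hb
  simp only [Prod.smul_mk, Prod.mk_add_mk, Pi.add_apply, Pi.smul_apply, smul_eq_mul] at h h' ⊢
  linarith

lemma isCompact_simSet (X Y : Type*) [Fintype Y] (M : ℝ) : IsCompact (simSet X Y M) := by
  have h : simSet X Y M = (Set.univ.pi (fun _ : X => stdSimplex ℝ Y) ×ˢ stdSimplex ℝ Y) ∩
      {w | ∀ x y, w.1 x y ≤ M * w.2 y} := by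
    ext w
    simp [simSet, IsChannel, IsProbDist, stdSimplex, and_assoc]
  rw [h]
  refine ((isCompact_univ_pi fun _ => isCompact_stdSimplex ℝ Y).prod
    (isCompact_stdSimplex ℝ Y)).inter_right ?_
  simp only [Set.ofPred_forall]
  exact isClosed_iInter fun x => isClosed_iInter fun y =>
    isClosed_le (by fun_prop) (by fun_prop)

lemma simSet_nonempty {X Y : Type*} [Nonempty X] [Fintype Y] {W : X → Y → ℝ} (hW : IsChannel W)
    {M : ℝ} (hM : 1 ≤ M) : (simSet X Y M).Nonempty := by
  obtain ⟨x₀⟩ := ‹Nonempty X›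
  exact ⟨(fun _ => W x₀, W x₀), fun _ => hW x₀, hW x₀,
    fun _ y => le_mul_of_one_le_left ((hW x₀).1 y) hM⟩

/-- The averaged Bhattacharyya coefficient has a saddle point. -/
lemma exists_isSaddlePointOn_bhattacharyya {X Y : Type*} [Fintype X] [Nonempty X] [Fintype Y]
    {W : X → Y → ℝ} (hW : IsChannel W) {M : ℝ} (hM : 1 ≤ M) :
    ∃ p ∈ stdSimplex ℝ X, ∃ w ∈ simSet X Y M,
      IsSaddlePointOn (stdSimplex ℝ X) (simSet X Y M)
        (fun p w => ∑ x, p x * bhattacharyya (W x) (w.1 x)) p w := by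
  refine Sion.exists_isSaddlePointOn ?_ (convex_stdSimplex ℝ X) (isCompact_stdSimplex ℝ X)
    (fun w _ => ?_) (fun w _ => ?_) (convex_simSet X Y M) (simSet_nonempty hW hM)
    (isCompact_simSet X Y M) (fun p _ => ?_) (fun p hp => ?_)
  · obtain ⟨x⟩ := ‹Nonempty X›
    exact ⟨_, single_mem_stdSimplex ℝ x⟩
  · exact (Continuous.lowerSemicontinuous (by fun_prop)).lowerSemicontinuousOn _
  · refine ConvexOn.quasiconvexOn ⟨convex_stdSimplex ℝ X, fun p _ r _ a b _ _ _ => le_of_eq ?_⟩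
    simp only [Pi.add_apply, Pi.smul_apply, smul_eq_mul, Finset.mul_sum,
      ← Finset.sum_add_distrib]
    exact Finset.sum_congr rfl fun x _ => by ring
  · have h (x : X) : Continuous fun w : (X → Y → ℝ) × (Y → ℝ) => bhattacharyya (W x) (w.1 x) :=
      (continuous_bhattacharyya (W x)).comp (by fun_prop)
    exact (Continuous.upperSemicontinuous (by fun_prop)).upperSemicontinuousOn _
  · refine ConcaveOn.quasiconcaveOn ⟨convex_simSet X Y M, fun v hv w hw a b ha hb hab => ?_⟩
    simp only [smul_eq_mul, Finset.mul_sum, ← Finset.sum_add_distrib]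
    refine Finset.sum_le_sum fun x _ => ?_
    have h := (concaveOn_bhattacharyya (hW x).1).2 (hv.1 x).1 (hw.1 x).1 ha hb hab
    simp only [smul_eq_mul] at h
    have h' := mul_le_mul_of_nonneg_left h (hp.1 x)
    simp only [Prod.fst_add, Prod.smul_fst, Pi.add_apply, Pi.smul_apply]
    linarith

end ChannelSim

open ChannelSim in
/-- minimax expression for the non-signaling simulation error of a classical
channel. -/
theorem statement15 {X Y : Type*} [Fintype X] [Nonempty X] [Fintype Y]
    (W : X → Y → ℝ) (hW : IsChannel W) (M : ℝ) (hM : 1 ≤ M) :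
    cEpsNS W M = ⨆ p : {p : X → ℝ // IsProbDist p},
      sInf { e : ℝ | ∃ (W' : X → Y → ℝ) (q : Y → ℝ), IsChannel W' ∧ IsProbDist q ∧
        (∀ x y, W' x y ≤ M * q y) ∧
        e = cPD (fun z : X × Y => p.1 z.1 * W z.1 z.2)
              (fun z : X × Y => p.1 z.1 * W' z.1 z.2) } := by
  have hbdd (p : {p : X → ℝ // IsProbDist p}) : BddBelow { e : ℝ | ∃ (W' : X → Y → ℝ) (q : Y → ℝ),
      IsChannel W' ∧ IsProbDist q ∧ (∀ x y, W' x y ≤ M * q y) ∧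
      e = cPD (fun z : X × Y => p.1 z.1 * W z.1 z.2) (fun z : X × Y => p.1 z.1 * W' z.1 z.2) } :=
    ⟨0, by rintro _ ⟨W', q, -, -, -, rfl⟩; exact cPD_nonneg _ _⟩
  obtain ⟨p₀, hp₀, ⟨V, r⟩, ⟨hV, hr, hVr⟩, hsaddle⟩ :=
    exists_isSaddlePointOn_bhattacharyya hW hM
  have : Nonempty {p : X → ℝ // IsProbDist p} := ⟨⟨p₀, hp₀⟩⟩
  apply le_antisymm
  · have hle : cEpsNS W M ≤ ⨆ x, cPD (W x) (V x) := by
      refine csInf_le ⟨0, ?_⟩ ⟨V, r, hV, hr, hVr, rfl⟩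
      rintro _ ⟨W', q, -, -, -, rfl⟩
      exact Real.iSup_nonneg fun x => cPD_nonneg _ _
    refine hle.trans ?_
    refine ciSup_le fun x => le_ciSup_of_le ⟨1, ?_⟩ ⟨p₀, hp₀⟩ (le_csInf ?_ ?_)
    · rintro _ ⟨p, rfl⟩
      exact (csInf_le (hbdd p) ⟨V, r, hV, hr, hVr, rfl⟩).trans (cPD_le_one _ _)
    · exact ⟨_, V, r, hV, hr, hVr, rfl⟩
    · rintro _ ⟨W', q, hW', hq, hWq, rfl⟩
      apply cPD_le_cPD
      rw [bhattacharyya_joint hp₀.1]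
      simpa [Pi.single_apply] using
        hsaddle _ (single_mem_stdSimplex ℝ x) (W', q) ⟨hW', hq, hWq⟩
  · refine ciSup_le fun p => le_csInf ⟨_, V, r, hV, hr, hVr, rfl⟩ ?_
    rintro _ ⟨W', q, hW', hq, hWq, rfl⟩
    refine (csInf_le (hbdd p) ⟨W', q, hW', hq, hWq, rfl⟩).trans ?_
    obtain ⟨x₀, hx₀⟩ := Finite.exists_min fun x => bhattacharyya (W x) (W' x)
    refine le_ciSup_of_le (Set.finite_range _).bddAbove x₀ (cPD_le_cPD ?_)
    rw [bhattacharyya_joint p.2.1]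
    calc bhattacharyya (W x₀) (W' x₀) = ∑ x, p.1 x * bhattacharyya (W x₀) (W' x₀) := by
          rw [← Finset.sum_mul, p.2.2, one_mul]
      _ ≤ _ := Finset.sum_le_sum fun x _ => mul_le_mul_of_nonneg_left (hx₀ x) (p.2.1 x)
end
end

section
/- Let W = {W_x}_{x∈𝒳} be a classical-quantum channel with outputs on a finite-dimensional Hilbert space B and let M ≥ 1. Then ε^NS(W,M) = sup_{p ∈ P(𝒳)} inf{ P(W∘p, W̃∘p) : W̃ = {W̃_x}_{x∈𝒳} a CQ channel on 𝒳 with outputs on B, σ a density matrix on B, and W̃_x ≼ M·σ in the Loewner order for all x∈𝒳 }, where W∘p denotes the block-diagonal density matrix Σ_{x∈𝒳} p(x)·|x⟩⟨x| ⊗ W_x on ℂ^{|𝒳|} ⊗ B. -/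
noncomputable section
open scoped BigOperators
open Classical
open scoped ComplexOrder

namespace ChannelSim

open scoped MatrixOrder Matrix.Norms.L2Operator

section MatrixSqrt

variable {n : Type*} [Fintype n] [DecidableEq n]

lemma matFun_sqrt_eq {A : Matrix n n ℂ} (hA : A.PosSemidef) :
    matFun Real.sqrt A = CFC.sqrt A := by
  have hA0 : 0 ≤ A := hA.nonneg
  rw [CFC.sqrt_eq_real_sqrt A hA0, cfcₙ_eq_cfc, hA.isHermitian.cfc_eq]
  simp only [matFun, dif_pos hA.isHermitian, Matrix.IsHermitian.cfc,
    Unitary.conjStarAlgAut_apply]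
  rfl

lemma matFun_sqrt_posSemidef {A : Matrix n n ℂ} (hA : A.PosSemidef) :
    (matFun Real.sqrt A).PosSemidef := by
  rw [matFun_sqrt_eq hA]
  exact Matrix.nonneg_iff_posSemidef.mp (CFC.sqrt_nonneg A)

lemma matFun_sqrt_mul_self {A : Matrix n n ℂ} (hA : A.PosSemidef) :
    matFun Real.sqrt A * matFun Real.sqrt A = A := by
  rw [matFun_sqrt_eq hA]
  exact CFC.sqrt_mul_sqrt_self A hA.nonneg

lemma matFun_sqrt_unique {A S : Matrix n n ℂ} (hS : S.PosSemidef) (h : S * S = A) :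
    matFun Real.sqrt A = S := by
  have hA : A.PosSemidef := by
    have := Matrix.posSemidef_conjTranspose_mul_self S
    rwa [hS.isHermitian.eq, h] at this
  rw [matFun_sqrt_eq hA]
  exact CFC.sqrt_unique h hS.nonneg

/-- The root fidelity `Tr √(√ρ σ √ρ)`. -/
def rootFid (ρ σ : Matrix n n ℂ) : ℝ :=
  ((matFun Real.sqrt (matFun Real.sqrt ρ * σ * matFun Real.sqrt ρ)).trace).re

lemma conj_sqrt_posSemidef {ρ σ : Matrix n n ℂ} (hρ : ρ.PosSemidef) (hσ : σ.PosSemidef) :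
    (matFun Real.sqrt ρ * σ * matFun Real.sqrt ρ).PosSemidef := by
  have := hσ.mul_mul_conjTranspose_same (matFun Real.sqrt ρ)
  rwa [(matFun_sqrt_posSemidef hρ).isHermitian.eq] at this

lemma rootFid_nonneg {ρ σ : Matrix n n ℂ} (hρ : ρ.PosSemidef) (hσ : σ.PosSemidef) :
    0 ≤ rootFid ρ σ :=
  (Complex.le_def.mp (matFun_sqrt_posSemidef (conj_sqrt_posSemidef hρ hσ)).trace_nonneg).1

lemma rootFid_concave {ρ σ τ : Matrix n n ℂ} (hρ : ρ.PosSemidef) (hσ : σ.PosSemidef)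
    (hτ : τ.PosSemidef) {a b : ℝ} (ha : 0 ≤ a) (hb : 0 ≤ b) (hab : a + b = 1) :
    a * rootFid ρ σ + b * rootFid ρ τ ≤ rootFid ρ (a • σ + b • τ) := by
  have hστ : (a • σ + b • τ).PosSemidef := (hσ.smul ha).add (hτ.smul hb)
  have h1 := conj_sqrt_posSemidef hρ hσ
  have h2 := conj_sqrt_posSemidef hρ hτ
  have key := (CFC.concaveOn_sqrt (A := Matrix n n ℂ)).2
    (Set.mem_Ici.mpr h1.nonneg) (Set.mem_Ici.mpr h2.nonneg) ha hb hab
  simp only [rootFid]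
  rw [matFun_sqrt_eq h1, matFun_sqrt_eq h2, matFun_sqrt_eq (conj_sqrt_posSemidef hρ hστ)]
  have e : matFun Real.sqrt ρ * (a • σ + b • τ) * matFun Real.sqrt ρ
      = a • (matFun Real.sqrt ρ * σ * matFun Real.sqrt ρ)
        + b • (matFun Real.sqrt ρ * τ * matFun Real.sqrt ρ) := by
    simp [mul_add, add_mul]
  rw [e]
  have ht := (Complex.le_def.mp (Matrix.le_iff.mp key).trace_nonneg).1
  simp only [Matrix.trace_sub, Matrix.trace_add, Matrix.trace_smul, Complex.zero_re,
    Complex.sub_re, Complex.add_re, Complex.smul_re, smul_eq_mul] at ht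
  linarith

end MatrixSqrt

section Joint

variable {X B : Type*} [DecidableEq X]

lemma cqJoint_eq_blockDiagonal (p : X → ℝ) (W : X → Matrix B B ℂ) :
    cqJoint p W = (Matrix.blockDiagonal fun x => (p x : ℂ) • W x).submatrix
      (Equiv.prodComm X B) (Equiv.prodComm X B) := by
  ext ⟨x, i⟩ ⟨y, j⟩
  simp [cqJoint, Matrix.blockDiagonal_apply]

lemma cqJoint_conjTranspose (p : X → ℝ) (W : X → Matrix B B ℂ) :
    (cqJoint p W).conjTranspose = cqJoint p fun x => (W x).conjTranspose := by
  simp [cqJoint_eq_blockDiagonal, Matrix.conjTranspose_submatrix,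
    Matrix.blockDiagonal_conjTranspose]

variable [Fintype X] [Fintype B]

lemma cqJoint_mul (p q : X → ℝ) (V W : X → Matrix B B ℂ) :
    cqJoint p V * cqJoint q W = cqJoint (fun x => p x * q x) (fun x => V x * W x) := by
  simp only [cqJoint_eq_blockDiagonal, Matrix.submatrix_mul_equiv, ← Matrix.blockDiagonal_mul]
  simp [smul_smul, mul_comm, -Complex.coe_smul]

lemma trace_cqJoint (p : X → ℝ) (W : X → Matrix B B ℂ) :
    (cqJoint p W).trace = ∑ x, (p x : ℂ) * (W x).trace := by
  simp [Matrix.trace, cqJoint, Fintype.sum_prod_type, Finset.mul_sum]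

variable [DecidableEq B]

lemma cqJoint_posSemidef {p : X → ℝ} (hp : ∀ x, 0 ≤ p x) {W : X → Matrix B B ℂ}
    (hW : ∀ x, (W x).PosSemidef) : (cqJoint p W).PosSemidef := by
  have h := Matrix.posSemidef_conjTranspose_mul_self
    (cqJoint (fun x => √(p x)) fun x => matFun Real.sqrt (W x))
  rw [cqJoint_conjTranspose, cqJoint_mul] at h
  simpa only [(matFun_sqrt_posSemidef (hW _)).isHermitian.eq, matFun_sqrt_mul_self (hW _),
    Real.mul_self_sqrt (hp _)] using h

lemma matFun_sqrt_cqJoint {p : X → ℝ} (hp : ∀ x, 0 ≤ p x) {W : X → Matrix B B ℂ}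
    (hW : ∀ x, (W x).PosSemidef) :
    matFun Real.sqrt (cqJoint p W)
      = cqJoint (fun x => √(p x)) fun x => matFun Real.sqrt (W x) := by
  apply matFun_sqrt_unique
  · exact cqJoint_posSemidef (fun x => Real.sqrt_nonneg _) fun x => matFun_sqrt_posSemidef (hW x)
  · simp only [cqJoint_mul, matFun_sqrt_mul_self (hW _), Real.mul_self_sqrt (hp _)]

lemma rootFid_cqJoint {p : X → ℝ} (hp : ∀ x, 0 ≤ p x) {V W : X → Matrix B B ℂ}
    (hV : ∀ x, (V x).PosSemidef) (hW : ∀ x, (W x).PosSemidef) :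
    rootFid (cqJoint p V) (cqJoint p W) = ∑ x, p x * rootFid (V x) (W x) := by
  have e : ∀ x, √(p x) * p x * √(p x) = p x * p x := fun x => by
    rw [mul_right_comm, Real.mul_self_sqrt (hp x)]
  simp only [rootFid]
  rw [matFun_sqrt_cqJoint hp hV, cqJoint_mul, cqJoint_mul]
  simp only [e]
  rw [matFun_sqrt_cqJoint (fun x => mul_self_nonneg _) fun x => conj_sqrt_posSemidef (hV x) (hW x),
    trace_cqJoint]
  simp [Real.sqrt_mul_self (hp _)]

end Joint

/-- A finite-dimensional minimax alternative: if every point of a nonempty convex set of real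
functions on a finite type has some coordinate bounded by `t`, then a single probability vector
bounds the average of every point of the set by `t`. -/
lemma exists_probDist_sum_le {X : Type*} [Fintype X] {C : Set (X → ℝ)}
    (hC : Convex ℝ C) (hne : C.Nonempty) {t : ℝ} (ht : ∀ v ∈ C, ∃ x, v x ≤ t) :
    ∃ p : X → ℝ, IsProbDist p ∧ ∀ v ∈ C, ∑ x, p x * v x ≤ t := by
  classical
  let S : Set (X → ℝ) := Set.univ.pi fun _ => Set.Ioi t
  have hS : Convex ℝ S := convex_pi fun _ _ => convex_Ioi t
  have hSo : IsOpen S := isOpen_set_pi Set.finite_univ fun _ _ => isOpen_Ioi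
  have hdisj : Disjoint S C := by
    rw [Set.disjoint_right]
    intro v hv hvS
    obtain ⟨x, hx⟩ := ht v hv
    exact absurd (hvS x (Set.mem_univ x)) (not_lt.mpr hx)
  obtain ⟨f, u, hfS, hfC⟩ := geometric_hahn_banach_open hS hSo hC hdisj
  let c : X → ℝ := fun x => -f (Pi.single x 1)
  have hf : ∀ v, f v = -∑ x, c x * v x := fun v => by
    have h := LinearMap.pi_apply_eq_sum_univ (f : (X → ℝ) →ₗ[ℝ] ℝ) v
    simp only [ContinuousLinearMap.coe_coe] at h
    rw [h, ← Finset.sum_neg_distrib]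
    refine Finset.sum_congr rfl fun x _ => ?_
    have e : (fun j => if x = j then (1 : ℝ) else 0) = Pi.single x 1 := by
      ext j
      simp [Pi.single_apply, eq_comm]
    rw [e]
    simp only [c, smul_eq_mul]
    ring
  have hSc : ∀ v : X → ℝ, (∀ x, t < v x) → -u < ∑ x, c x * v x := fun v hv => by
    have := hfS v fun x _ => hv x
    rw [hf] at this
    linarith
  have hCc : ∀ v ∈ C, ∑ x, c x * v x ≤ -u := fun v hv => by
    have := hfC v hv
    rw [hf] at this
    linarith
  have hconst : ∀ s, ∑ x, c x * s = (∑ x, c x) * s := fun s => (Finset.sum_mul ..).symm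
  have hc : ∀ x, 0 ≤ c x := by
    intro x
    by_contra! hx
    have hlim : ∀ s, 0 ≤ s → -u < (∑ y, c y) * (t + 1) + c x * s := fun s hs => by
      have := hSc (fun y => (t + 1) + (Pi.single x s : X → ℝ) y) fun y => by
        have : 0 ≤ (Pi.single x s : X → ℝ) y := by
          rw [Pi.single_apply]
          split_ifs <;> simp [hs]
        linarith
      simpa [mul_add, Finset.sum_add_distrib, ← Finset.sum_mul, Pi.single_apply] using this
    have h0 := hlim 0 le_rfl
    have h1 := hlim ((-u - (∑ y, c y) * (t + 1)) / c x)
      (div_nonneg_of_nonpos (by linarith) hx.le)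
    rw [mul_div_cancel₀ _ hx.ne] at h1
    linarith
  have hk : 0 < ∑ x, c x := by
    refine lt_of_le_of_ne (Finset.sum_nonneg fun x _ => hc x) fun h => ?_
    obtain ⟨v, hv⟩ := hne
    have h0 : ∀ x, c x = 0 := fun x =>
      (Finset.sum_eq_zero_iff_of_nonneg fun y _ => hc y).mp h.symm x (Finset.mem_univ x)
    have h1 := hCc v hv
    have h2 := hSc (fun _ => t + 1) fun _ => lt_add_one t
    simp only [h0, zero_mul, Finset.sum_const_zero] at h1 h2
    linarith
  refine ⟨fun x => c x / ∑ y, c y, ⟨fun x => div_nonneg (hc x) hk.le, ?_⟩, fun v hv => ?_⟩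
  · rw [← Finset.sum_div, div_self hk.ne']
  · by_contra! hlt
    have h1 := hSc _ fun _ => hlt
    rw [hconst] at h1
    have h2 : (∑ x, c x) * ∑ x, c x / (∑ y, c y) * v x = ∑ x, c x * v x := by
      rw [Finset.mul_sum]
      refine Finset.sum_congr rfl fun x _ => ?_
      field_simp
    linarith [hCc v hv]

lemma qPD_eq {n : Type*} [Fintype n] [DecidableEq n] (ρ σ : Matrix n n ℂ) :
    qPD ρ σ = √(1 - rootFid ρ σ ^ 2) := rfl

lemma qPD_le_one {n : Type*} [Fintype n] [DecidableEq n] (ρ σ : Matrix n n ℂ) :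
    qPD ρ σ ≤ 1 := by
  rw [qPD_eq]
  exact Real.sqrt_le_one.mpr (by nlinarith [sq_nonneg (rootFid ρ σ)])

/-- The pairs of a channel and a density matrix available with communication size `M`. -/
def IsFeasible {X B : Type*} [Fintype B] [DecidableEq B] (M : ℝ) (W : X → Matrix B B ℂ)
    (σ : Matrix B B ℂ) : Prop :=
  (∀ x, IsDensity (W x)) ∧ IsDensity σ ∧ ∀ x, (M • σ - W x).PosSemidef

lemma IsDensity.convexComb {n : Type*} [Fintype n] [DecidableEq n] {ρ σ : Matrix n n ℂ}
    (hρ : IsDensity ρ) (hσ : IsDensity σ) {a b : ℝ} (ha : 0 ≤ a) (hb : 0 ≤ b)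
    (hab : a + b = 1) : IsDensity (a • ρ + b • σ) := by
  refine ⟨(hρ.1.smul ha).add (hσ.1.smul hb), ?_⟩
  rw [Matrix.trace_add, Matrix.trace_smul, Matrix.trace_smul, hρ.2, hσ.2, ← add_smul, hab,
    one_smul]

lemma IsFeasible.convexComb {X B : Type*} [Fintype B] [DecidableEq B] {M : ℝ}
    {V W : X → Matrix B B ℂ} {σ τ : Matrix B B ℂ} (hV : IsFeasible M V σ)
    (hW : IsFeasible M W τ) {a b : ℝ} (ha : 0 ≤ a) (hb : 0 ≤ b) (hab : a + b = 1) :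
    IsFeasible M (fun x => a • V x + b • W x) (a • σ + b • τ) := by
  refine ⟨fun x => (hV.1 x).convexComb (hW.1 x) ha hb hab, hV.2.1.convexComb hW.2.1 ha hb hab,
    fun x => ?_⟩
  convert ((hV.2.2 x).smul ha).add ((hW.2.2 x).smul hb) using 1
  module

lemma IsFeasible.const {X B : Type*} [Fintype B] [DecidableEq B] {M : ℝ} (hM : 1 ≤ M)
    {σ : Matrix B B ℂ} (hσ : IsDensity σ) : IsFeasible M (fun _ : X => σ) σ := by
  refine ⟨fun _ => hσ, hσ, fun _ => ?_⟩
  convert hσ.1.smul (sub_nonneg.mpr hM) using 1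
  module

/-- The root fidelity vectors reachable with communication size `M`, closed downwards, form a
convex set. -/
lemma convex_rootFid_lowerSet {X B : Type*} [Fintype B] [DecidableEq B]
    {W : X → Matrix B B ℂ} (hW : ∀ x, IsDensity (W x)) (M : ℝ) :
    Convex ℝ {v : X → ℝ | ∃ W' σ, IsFeasible M W' σ ∧ ∀ x, v x ≤ rootFid (W x) (W' x)} := by
  rintro v ⟨V', σ, hV, hv⟩ w ⟨W', τ, hW', hw⟩ a b ha hb hab
  refine ⟨_, _, hV.convexComb hW' ha hb hab, fun x => ?_⟩
  refine le_trans ?_ (rootFid_concave (hW x).1 (hV.1 x).1 (hW'.1 x).1 ha hb hab)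
  simp only [Pi.add_apply, Pi.smul_apply, smul_eq_mul]
  exact add_le_add (mul_le_mul_of_nonneg_left (hv x) ha) (mul_le_mul_of_nonneg_left (hw x) hb)

end ChannelSim

open ChannelSim in
/-- minimax expression for the non-signaling simulation error of a
classical-quantum channel. -/
theorem statement16 {X B : Type*} [Fintype X] [DecidableEq X] [Nonempty X]
    [Fintype B] [DecidableEq B]
    (W : X → Matrix B B ℂ) (hW : ∀ x, IsDensity (W x)) (M : ℝ) (hM : 1 ≤ M) :
    qEpsNS W M = ⨆ p : {p : X → ℝ // IsProbDist p},
      sInf { e : ℝ | ∃ (W' : X → Matrix B B ℂ) (σ : Matrix B B ℂ),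
        (∀ x, IsDensity (W' x)) ∧ IsDensity σ ∧ (∀ x, (M • σ - W' x).PosSemidef) ∧
        e = qPD (cqJoint p.1 W) (cqJoint p.1 W') } := by
  have hbdd : ∀ S : Set ℝ, (∀ e ∈ S, 0 ≤ e) → BddBelow S := fun S hS => ⟨0, hS⟩
  have hsup : ∀ W' : X → Matrix B B ℂ, BddAbove (Set.range fun x => qPD (W x) (W' x)) :=
    fun W' => (Set.finite_range _).bddAbove
  have hjoint : ∀ p : {p : X → ℝ // IsProbDist p}, ∀ W' σ, IsFeasible M W' σ →
      rootFid (cqJoint p.1 W) (cqJoint p.1 W') = ∑ x, p.1 x * rootFid (W x) (W' x) :=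
    fun p W' σ h => rootFid_cqJoint p.2.1 (fun x => (hW x).1) fun x => (h.1 x).1
  have hnonneg : ∀ W' σ, IsFeasible M W' σ → ∀ x, 0 ≤ rootFid (W x) (W' x) :=
    fun W' σ h x => rootFid_nonneg (hW x).1 (h.1 x).1
  have x₀ : X := Classical.arbitrary X
  have hconst := IsFeasible.const (X := X) hM (hW x₀)
  have hinner : ∀ p : {p : X → ℝ // IsProbDist p}, ∀ W' σ, IsFeasible M W' σ →
      sInf { e : ℝ | ∃ (W' : X → Matrix B B ℂ) (σ : Matrix B B ℂ),
        (∀ x, IsDensity (W' x)) ∧ IsDensity σ ∧ (∀ x, (M • σ - W' x).PosSemidef) ∧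
        e = qPD (cqJoint p.1 W) (cqJoint p.1 W') } ≤ qPD (cqJoint p.1 W) (cqJoint p.1 W') := by
    rintro p W' σ ⟨h1, h2, h3⟩
    refine csInf_le (hbdd _ ?_) ⟨W', σ, h1, h2, h3, rfl⟩
    rintro e ⟨-, -, -, -, -, rfl⟩
    exact Real.sqrt_nonneg _
  have hinner_bdd : BddAbove (Set.range fun p : {p : X → ℝ // IsProbDist p} =>
      sInf { e : ℝ | ∃ (W' : X → Matrix B B ℂ) (σ : Matrix B B ℂ),
        (∀ x, IsDensity (W' x)) ∧ IsDensity σ ∧ (∀ x, (M • σ - W' x).PosSemidef) ∧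
        e = qPD (cqJoint p.1 W) (cqJoint p.1 W') }) := by
    refine ⟨1, ?_⟩
    rintro _ ⟨p, rfl⟩
    exact (hinner p _ _ hconst).trans (qPD_le_one _ _)
  apply le_antisymm
  · have hL : ∀ W' σ, IsFeasible M W' σ → qEpsNS W M ≤ ⨆ x, qPD (W x) (W' x) := by
      rintro W' σ ⟨h1, h2, h3⟩
      refine csInf_le (hbdd _ ?_) ⟨W', σ, h1, h2, h3, rfl⟩
      rintro e ⟨-, -, -, -, -, rfl⟩
      exact Real.iSup_nonneg fun x => Real.sqrt_nonneg _
    rcases le_or_gt (qEpsNS W M) 0 with hL0 | hL0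
    · refine hL0.trans (Real.iSup_nonneg fun p => Real.sInf_nonneg ?_)
      rintro e ⟨-, -, -, -, -, rfl⟩
      exact Real.sqrt_nonneg _
    have hne : { v : X → ℝ | ∃ W' σ, IsFeasible M W' σ ∧
        ∀ x, v x ≤ rootFid (W x) (W' x) }.Nonempty := ⟨_, _, _, hconst, fun x => le_rfl⟩
    obtain ⟨p, hp, hpt⟩ := exists_probDist_sum_le (convex_rootFid_lowerSet hW M) hne
      (t := √(1 - qEpsNS W M ^ 2)) <| by
        rintro v ⟨W', σ, h, hv⟩
        obtain ⟨x, hx⟩ := exists_eq_ciSup_of_finite (f := fun x => qPD (W x) (W' x))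
        refine ⟨x, (hv x).trans (Real.le_sqrt_of_sq_le ?_)⟩
        have h1 : qEpsNS W M ≤ √(1 - rootFid (W x) (W' x) ^ 2) :=
          (hL W' σ h).trans_eq hx.symm
        linarith [(Real.le_sqrt' hL0).mp h1]
    refine le_trans ?_ (le_ciSup hinner_bdd ⟨p, hp⟩)
    refine le_csInf ⟨_, _, _, hconst.1, hconst.2.1, hconst.2.2, rfl⟩ ?_
    rintro e ⟨W', σ, h1, h2, h3, rfl⟩
    have h : IsFeasible M W' σ := ⟨h1, h2, h3⟩
    have hle := hpt (fun x => rootFid (W x) (W' x)) ⟨W', σ, h, fun x => le_rfl⟩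
    have hL1 : qEpsNS W M ≤ 1 :=
      (hL _ _ hconst).trans (ciSup_le fun x => qPD_le_one _ _)
    rw [qPD_eq, hjoint ⟨p, hp⟩ W' σ h]
    apply Real.le_sqrt_of_sq_le
    have h0 : 0 ≤ ∑ x, p x * rootFid (W x) (W' x) :=
      Finset.sum_nonneg fun x _ => mul_nonneg (hp.1 x) (hnonneg W' σ h x)
    have := (Real.le_sqrt h0 (by nlinarith)).mp hle
    linarith
  · have : Nonempty {p : X → ℝ // IsProbDist p} :=
      ⟨Pi.single x₀ 1, fun x => by rw [Pi.single_apply]; split_ifs <;> simp, by simp⟩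
    refine ciSup_le fun p => le_csInf ⟨_, _, _, hconst.1, hconst.2.1, hconst.2.2, rfl⟩ ?_
    rintro e ⟨W', σ, h1, h2, h3, rfl⟩
    have h : IsFeasible M W' σ := ⟨h1, h2, h3⟩
    refine (hinner p W' σ h).trans ?_
    obtain ⟨x, hx⟩ := Finite.exists_min fun x => rootFid (W x) (W' x)
    refine le_trans (Real.sqrt_le_sqrt ?_) (le_ciSup (hsup W') x)
    have hmin : rootFid (W x) (W' x) ≤ rootFid (cqJoint p.1 W) (cqJoint p.1 W') := by
      rw [hjoint p W' σ h]
      calc rootFid (W x) (W' x) = ∑ y, p.1 y * rootFid (W x) (W' x) := by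
            rw [← Finset.sum_mul, p.2.2, one_mul]
        _ ≤ _ := Finset.sum_le_sum fun y _ => mul_le_mul_of_nonneg_left (hx y) (p.2.1 y)
    exact sub_le_sub_left (pow_le_pow_left₀ (hnonneg W' σ h x) hmin 2) 1
end
end

section
/- Let ρ and ω be density matrices on a finite-dimensional Hilbert space ℋ such that ρ and ω commute and supp(ρ) ⊆ supp(ω). Then var(ρ‖ω) ≤ 2 log²(dim ℋ) + log²(‖ω‖_min) + 4, where ‖ω‖_min denotes the minimal nonzero eigenvalue of ω. -/
noncomputable section
open scoped BigOperators
open Classical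
open scoped ComplexOrder

namespace ChannelSim

open Matrix

section FunctionalCalculus

variable {n : Type*} [Fintype n] [DecidableEq n]

lemma matFun_mul (f g : ℝ → ℝ) (A : Matrix n n ℂ) :
    matFun f A * matFun g A = matFun (fun t => f t * g t) A := by
  by_cases hA : A.IsHermitian
  · have hU : star (hA.eigenvectorUnitary : Matrix n n ℂ) * (hA.eigenvectorUnitary : Matrix n n ℂ)
        = 1 := Unitary.coe_star_mul_self hA.eigenvectorUnitary
    simp only [matFun, dif_pos hA]
    calc _ = (hA.eigenvectorUnitary : Matrix n n ℂ) *
          diagonal (fun i => ((f (hA.eigenvalues i)) : ℂ)) *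
          (star (hA.eigenvectorUnitary : Matrix n n ℂ) *
            (hA.eigenvectorUnitary : Matrix n n ℂ)) *
          diagonal (fun i => ((g (hA.eigenvalues i)) : ℂ)) *
          star (hA.eigenvectorUnitary : Matrix n n ℂ) := by simp only [Matrix.mul_assoc]
      _ = _ := by
        rw [hU, Matrix.mul_one, Matrix.mul_assoc (hA.eigenvectorUnitary : Matrix n n ℂ),
          diagonal_mul_diagonal]
        simp only [Complex.ofReal_mul]
  · simp [matFun, hA]

lemma matFun_id {A : Matrix n n ℂ} (hA : A.IsHermitian) : matFun (fun t => t) A = A := by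
  rw [matFun, dif_pos hA]
  conv_rhs => rw [hA.spectral_theorem]
  rfl

lemma matFun_one {A : Matrix n n ℂ} (hA : A.IsHermitian) : matFun (fun _ => 1) A = 1 := by
  rw [matFun, dif_pos hA]
  simp

/-- Squared overlaps of the eigenvectors of two Hermitian matrices. -/
def eigenOverlap {A B : Matrix n n ℂ} (hA : A.IsHermitian) (hB : B.IsHermitian) (i j : n) : ℝ :=
  Complex.normSq ((star (hA.eigenvectorUnitary : Matrix n n ℂ) *
    (hB.eigenvectorUnitary : Matrix n n ℂ)) i j)

lemma trace_matFun_mul_matFun {A B : Matrix n n ℂ} (hA : A.IsHermitian) (hB : B.IsHermitian)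
    (f g : ℝ → ℝ) :
    ((matFun f A * matFun g B).trace).re =
      ∑ i, ∑ j, eigenOverlap hA hB i j * (f (hA.eigenvalues i) * g (hB.eigenvalues j)) := by
  simp only [matFun, dif_pos hA, dif_pos hB, eigenOverlap]
  set U : Matrix n n ℂ := (hA.eigenvectorUnitary : Matrix n n ℂ)
  set V : Matrix n n ℂ := (hB.eigenvectorUnitary : Matrix n n ℂ)
  set D := diagonal (fun i => ((f (hA.eigenvalues i)) : ℂ)) with hD
  set E := diagonal (fun i => ((g (hB.eigenvalues i)) : ℂ)) with hE
  have h : (U * D * star U * (V * E * star V)).trace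
      = ((D * (star U * V)) * (E * star (star U * V))).trace := by
    rw [star_mul, star_star, Matrix.mul_assoc U, Matrix.mul_assoc U, trace_mul_comm U]
    simp only [Matrix.mul_assoc]
  rw [h, trace, Complex.re_sum]
  refine Finset.sum_congr rfl fun i _ => ?_
  rw [diag_apply, mul_apply, Complex.re_sum]
  refine Finset.sum_congr rfl fun j _ => ?_
  rw [hD, hE, diagonal_mul, diagonal_mul, star_apply]
  simp only [Complex.normSq_apply, Complex.star_def, Complex.mul_re, Complex.mul_im,
    Complex.conj_re, Complex.conj_im, Complex.ofReal_re, Complex.ofReal_im]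
  ring

lemma trace_mul_sub_sq {A B : Matrix n n ℂ} (hA : A.IsHermitian) (hB : B.IsHermitian)
    (f g : ℝ → ℝ) :
    ((A * (matFun f A - matFun g B) ^ 2).trace).re =
      ∑ i, ∑ j, eigenOverlap hA hB i j *
        (hA.eigenvalues i * (f (hA.eigenvalues i) - g (hB.eigenvalues j)) ^ 2) := by
  have hAf : A * matFun f A = matFun (fun t => t * f t) A := by
    simpa only [matFun_id hA] using matFun_mul (fun t => t) f A
  have hfA : matFun f A * A = matFun (fun t => t * f t) A := by
    simpa only [matFun_id hA, mul_comm] using matFun_mul f (fun t => t) A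
  have h1 : (A * matFun f A * matFun f A).trace
      = (matFun (fun t => t * f t * f t) A * matFun (fun _ => 1) B).trace := by
    rw [hAf, matFun_mul, matFun_one hB, Matrix.mul_one]
  have h2 : (A * matFun f A * matFun g B).trace
      = (matFun (fun t => t * f t) A * matFun g B).trace := by rw [hAf]
  have h3 : (A * matFun g B * matFun f A).trace
      = (matFun (fun t => t * f t) A * matFun g B).trace := by
    rw [trace_mul_comm, ← Matrix.mul_assoc, hfA]
  have h4 : (A * matFun g B * matFun g B).trace
      = (matFun (fun t => t) A * matFun (fun t => g t * g t) B).trace := by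
    rw [Matrix.mul_assoc, matFun_mul, matFun_id hA]
  have h : (A * (matFun f A - matFun g B) ^ 2).trace =
      (A * matFun f A * matFun f A).trace - (A * matFun f A * matFun g B).trace
        - (A * matFun g B * matFun f A).trace + (A * matFun g B * matFun g B).trace := by
    rw [← trace_sub, ← trace_sub, ← trace_add]
    congr 1
    noncomm_ring
  rw [h, h1, h2, h3, h4, Complex.add_re, Complex.sub_re, Complex.sub_re]
  simp only [trace_matFun_mul_matFun hA hB, ← Finset.sum_sub_distrib, ← Finset.sum_add_distrib]
  refine Finset.sum_congr rfl fun i _ => Finset.sum_congr rfl fun j _ => ?_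
  ring

lemma IsDensity.sum_eigenvalues {ρ : Matrix n n ℂ} (hρ : IsDensity ρ) :
    ∑ i, hρ.1.isHermitian.eigenvalues i = 1 := by
  have h := hρ.1.isHermitian.trace_eq_sum_eigenvalues
  have h1 := hρ.2.symm.trans h
  rw [← RCLike.ofReal_sum] at h1
  exact RCLike.ofReal_injective (K := ℂ) (by simpa using h1.symm)

lemma IsDensity.eigenvalues_le_one {ρ : Matrix n n ℂ} (hρ : IsDensity ρ) (i : n) :
    hρ.1.isHermitian.eigenvalues i ≤ 1 := by
  rw [← hρ.sum_eigenvalues]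
  exact Finset.single_le_sum (fun j _ => hρ.1.eigenvalues_nonneg j) (Finset.mem_univ i)

lemma sq_log_eigenvalues_le {ω : Matrix n n ℂ} (hω : IsDensity ω) (j : n) :
    Real.log (hω.1.isHermitian.eigenvalues j) ^ 2 ≤ Real.log (minPosEig ω) ^ 2 := by
  set q := hω.1.isHermitian.eigenvalues j with hq
  rcases (hω.1.eigenvalues_nonneg j).eq_or_lt with h0 | h0
  · rw [hq, ← h0, Real.log_zero, zero_pow two_ne_zero]
    exact sq_nonneg _
  · set S := {t : ℝ | 0 < t ∧ ∃ i, hω.1.isHermitian.eigenvalues i = t} with hS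
    have hmin : minPosEig ω = sInf S := by rw [minPosEig, dif_pos hω.1.isHermitian]
    have hfin : S.Finite :=
      (Set.finite_range hω.1.isHermitian.eigenvalues).subset fun t ht => ht.2
    have hqS : q ∈ S := ⟨h0, j, rfl⟩
    have hpos : 0 < sInf S := (Set.Nonempty.csInf_mem ⟨q, hqS⟩ hfin).1
    have hle : sInf S ≤ q := csInf_le hfin.bddBelow hqS
    rw [hmin]
    have hlog := Real.log_le_log hpos hle
    have hlog' : Real.log q ≤ 0 := Real.log_nonpos h0.le (hω.eigenvalues_le_one j)
    nlinarith

end FunctionalCalculus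

/-- `p log² p` is dominated by `2 p log² d + 4 / d` for `p ∈ [0, 1]` and `d ≥ 1`. -/
lemma mul_sq_log_le {p d : ℝ} (hp0 : 0 ≤ p) (hp1 : p ≤ 1) (hd : 1 ≤ d) :
    p * Real.log p ^ 2 ≤ 2 * p * Real.log d ^ 2 + 4 / d := by
  have hd0 : 0 < d := by linarith
  rcases hp0.eq_or_lt with rfl | hp
  · simp only [zero_mul, mul_zero, zero_add]
    positivity
  have hlp : Real.log p ≤ 0 := Real.log_nonpos hp0 hp1
  have hld : 0 ≤ Real.log d := Real.log_nonneg hd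
  have hmul : Real.log (d * p) = Real.log d + Real.log p := Real.log_mul hd0.ne' hp.ne'
  have h4 : 0 < 4 / d := by positivity
  rcases le_total (Real.log (d * p)) 0 with hx | hx
  · have hexp := Real.quadratic_le_exp_of_nonneg (neg_nonneg.mpr hx)
    rw [Real.exp_neg, Real.exp_log (by positivity)] at hexp
    have hsq : Real.log (d * p) ^ 2 ≤ 2 * (d * p)⁻¹ := by nlinarith
    have hpsq : p * Real.log (d * p) ^ 2 ≤ 2 / d := by
      calc p * Real.log (d * p) ^ 2 ≤ p * (2 * (d * p)⁻¹) := by gcongr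
        _ = 2 / d := by field_simp
    have hsplit : Real.log p ^ 2 ≤ 2 * Real.log d ^ 2 + 2 * Real.log (d * p) ^ 2 := by
      rw [hmul]
      nlinarith [sq_nonneg (2 * Real.log d + Real.log p)]
    have h42 : 4 / d = 2 * (2 / d) := by ring
    nlinarith [mul_le_mul_of_nonneg_left hsplit hp0]
  · have hsq : Real.log p ^ 2 ≤ Real.log d ^ 2 := by nlinarith
    nlinarith [mul_le_mul_of_nonneg_left hsq hp0, mul_nonneg hp0 (sq_nonneg (Real.log d))]

end ChannelSim

open ChannelSim in
/-- bound on the relative-entropy variance of commuting density matrices. -/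
theorem statement19 {d : ℕ} (ρ ω : Matrix (Fin d) (Fin d) ℂ)
    (hρ : IsDensity ρ) (hω : IsDensity ω) (hcomm : ρ * ω = ω * ρ)
    (hsupp : ∀ v, ω.mulVec v = 0 → ρ.mulVec v = 0) :
    varQ ρ ω ≤ 2 * Real.log d ^ 2 + Real.log (minPosEig ω) ^ 2 + 4 := by
  have hA := hρ.1.isHermitian
  have hB := hω.1.isHermitian
  have hd : d ≠ 0 := by
    rintro rfl
    simpa [Matrix.trace] using hρ.2
  have hd1 : (1 : ℝ) ≤ d := by exact_mod_cast Nat.one_le_iff_ne_zero.mpr hd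
  have hmass : ∑ i, ∑ j, eigenOverlap hA hB i j * (hA.eigenvalues i * 1) = 1 := by
    rw [← trace_matFun_mul_matFun hA hB (fun t => t) (fun _ => 1), matFun_id hA, matFun_one hB,
      Matrix.mul_one, hρ.2, Complex.one_re]
  have hdim : ∑ i, ∑ j, eigenOverlap hA hB i j * (1 * 1) = d := by
    rw [← trace_matFun_mul_matFun hA hB (fun _ => 1) (fun _ => 1), matFun_one hA, matFun_one hB,
      Matrix.mul_one, Matrix.trace_one, Fintype.card_fin, Complex.natCast_re]
  set L := Real.log (minPosEig ω) ^ 2 with hL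
  have hterm : ∀ i j, eigenOverlap hA hB i j *
      (hA.eigenvalues i * (Real.log (hA.eigenvalues i) - Real.log (hB.eigenvalues j)) ^ 2) ≤
      (2 * Real.log d ^ 2 + L) * (eigenOverlap hA hB i j * (hA.eigenvalues i * 1)) +
        4 / d * (eigenOverlap hA hB i j * (1 * 1)) := by
    intro i j
    have hp0 : 0 ≤ hA.eigenvalues i := hρ.1.eigenvalues_nonneg i
    have hp1 : hA.eigenvalues i ≤ 1 := hρ.eigenvalues_le_one i
    have hq0 : 0 ≤ hB.eigenvalues j := hω.1.eigenvalues_nonneg j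
    have hq1 : hB.eigenvalues j ≤ 1 := hω.eigenvalues_le_one j
    have hp := mul_sq_log_le hp0 hp1 hd1
    have hq : Real.log (hB.eigenvalues j) ^ 2 ≤ L := sq_log_eigenvalues_le hω j
    have hcross := mul_nonneg_of_nonpos_of_nonpos (Real.log_nonpos hp0 hp1)
      (Real.log_nonpos hq0 hq1)
    have hw : 0 ≤ eigenOverlap hA hB i j := Complex.normSq_nonneg _
    have hbound : hA.eigenvalues i *
        (Real.log (hA.eigenvalues i) - Real.log (hB.eigenvalues j)) ^ 2 ≤
        (2 * Real.log d ^ 2 + L) * hA.eigenvalues i + 4 / d := by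
      linarith [mul_nonneg hp0 hcross, mul_le_mul_of_nonneg_left hq hp0]
    linarith [mul_le_mul_of_nonneg_left hbound hw]
  calc varQ ρ ω ≤ ((ρ * (matFun Real.log ρ - matFun Real.log ω) ^ 2).trace).re :=
        sub_le_self _ (sq_nonneg _)
    _ = ∑ i, ∑ j, eigenOverlap hA hB i j * (hA.eigenvalues i *
          (Real.log (hA.eigenvalues i) - Real.log (hB.eigenvalues j)) ^ 2) :=
        trace_mul_sub_sq hA hB Real.log Real.log
    _ ≤ ∑ i, ∑ j, ((2 * Real.log d ^ 2 + L) *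
          (eigenOverlap hA hB i j * (hA.eigenvalues i * 1)) +
          4 / d * (eigenOverlap hA hB i j * (1 * 1))) :=
        Finset.sum_le_sum fun i _ => Finset.sum_le_sum fun j _ => hterm i j
    _ = (2 * Real.log d ^ 2 + L) * 1 + 4 / d * d := by
        simp only [Finset.sum_add_distrib, ← Finset.mul_sum]
        rw [hmass, hdim]
    _ = 2 * Real.log d ^ 2 + L + 4 := by
        rw [mul_one, div_mul_cancel₀ _ (by positivity)]
end
end
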